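/- Let a pairwise graphical model be binary, i.e. Y_u = {0,1} for every node u. Let μ' be a minimizer of μ ↦ ⟨θ,μ⟩ over the local polytope L, let A = {u ∈ V : μ'_u ∈ {0,1}^{Y_u}} be the set of nodes where μ' is integral, and for u ∈ A let y'_u be the label with μ'_u(y'_u) = 1. Then the partial labeling y' is persistent: there exists a labeling y* minimizing the energy E(·;θ) over all labelings such that y*_u = y'_u for every u ∈ A. -/

import Mathlib

open Finset

variable {V : Type} [Fintype V] [DecidableEq V]

/-- Membership in the local polytope `L`: `μ ≥ 0`, each unary block lies in the
probability simplex, both coupling (marginalization) constraints hold, the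
pairwise blocks are symmetric (one variable per unordered edge) and vanish on
non-edges. -/
def memLocal (G : SimpleGraph V) [DecidableRel G.Adj]
    (Y : V → Type) [∀ u, Fintype (Y u)]
    (μv : ∀ u, Y u → ℝ) (μe : ∀ u v, Y u → Y v → ℝ) : Prop :=
  (∀ u s, 0 ≤ μv u s) ∧
  (∀ u v, G.Adj u v → ∀ s t, 0 ≤ μe u v s t) ∧
  (∀ u v s t, μe u v s t = μe v u t s) ∧
  (∀ u v, ¬ G.Adj u v → ∀ s t, μe u v s t = 0) ∧
  (∀ u, ∑ s, μv u s = 1) ∧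
  (∀ u v, G.Adj u v → ∀ t : Y v, ∑ s, μe u v s t = μv v t) ∧
  (∀ u v, G.Adj u v → ∀ s : Y u, ∑ t, μe u v s t = μv u s)

/-- The objective `⟨θ, μ⟩` of the local polytope relaxation
(each unordered edge counted once via the halved sum over ordered pairs). -/
noncomputable def ip (G : SimpleGraph V) [DecidableRel G.Adj]
    (Y : V → Type) [∀ u, Fintype (Y u)]
    (θv : ∀ u, Y u → ℝ) (θe : ∀ u v, Y u → Y v → ℝ)
    (μv : ∀ u, Y u → ℝ) (μe : ∀ u v, Y u → Y v → ℝ) : ℝ :=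
  (∑ u, ∑ s, θv u s * μv u s) +
    (∑ u, ∑ v, if G.Adj u v then ∑ s, ∑ t, θe u v s t * μe u v s t else 0) / 2

/-- The energy `E(y;θ) = Σ_u θ_u(y_u) + Σ_{uv∈E} θ_{uv}(y_u,y_v)` of a labeling
of a binary model (each unordered edge counted once via the halved sum over
ordered pairs). -/
noncomputable def energyB (G : SimpleGraph V) [DecidableRel G.Adj]
    (θv : V → Bool → ℝ) (θe : V → V → Bool → Bool → ℝ) (y : V → Bool) : ℝ :=
  (∑ u, θv u (y u)) +
    (∑ u, ∑ v, if G.Adj u v then θe u v (y u) (y v) else 0) / 2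

/-- The zero-one unary block of the labeling `y`. -/
def labelUnary {V : Type} (y : V → Bool) (u : V) (s : Bool) : ℝ := if s = y u then 1 else 0

/-- Moving from `(μv, μe)` along the difference of two labelings changes the objective by the
scaled difference of their energies. -/
lemma ip_add_label_sub {V : Type} [Fintype V] (G : SimpleGraph V) [DecidableRel G.Adj]
    (θv : V → Bool → ℝ) (θe : V → V → Bool → Bool → ℝ)
    (μv : V → Bool → ℝ) (μe : V → V → Bool → Bool → ℝ) (ε : ℝ) (y z : V → Bool) :
    ip G (fun _ => Bool) θv θe
      (fun u s => μv u s + ε * (labelUnary y u s - labelUnary z u s))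
      (fun u v s t => if G.Adj u v then μe u v s t + ε *
        (labelUnary y u s * labelUnary y v t - labelUnary z u s * labelUnary z v t) else 0) =
    ip G (fun _ => Bool) θv θe μv μe + ε * (energyB G θv θe y - energyB G θv θe z) := by
  have hv : ∀ u, ∑ s, θv u s * (μv u s + ε * (labelUnary y u s - labelUnary z u s)) =
      ∑ s, θv u s * μv u s + ε * (θv u (y u) - θv u (z u)) := by
    intro u
    cases hy : y u <;> cases hz : z u <;> simp [labelUnary, hy, hz] <;> ring
  have he : ∀ u v, (if G.Adj u v then ∑ s, ∑ t, θe u v s t *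
        (if G.Adj u v then μe u v s t + ε *
          (labelUnary y u s * labelUnary y v t - labelUnary z u s * labelUnary z v t)
          else 0) else 0) =
      (if G.Adj u v then ∑ s, ∑ t, θe u v s t * μe u v s t else 0) +
        ε * ((if G.Adj u v then θe u v (y u) (y v) else 0) -
          (if G.Adj u v then θe u v (z u) (z v) else 0)) := by
    intro u v
    by_cases h : G.Adj u v
    · cases hy : y u <;> cases hz : z u <;> cases hy' : y v <;> cases hz' : z v <;>
        simp [labelUnary, h, hy, hz, hy', hz'] <;> ring
    · simp [h]
  simp only [ip, energyB, hv, he, sum_add_distrib, ← mul_sum, sum_sub_distrib]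
  ring

/-- Moving a point of the local polytope along the difference of two labelings stays in the
polytope as long as the entries that decrease are at least the step size. -/
lemma memLocal_add_label_sub {V : Type} (G : SimpleGraph V) [DecidableRel G.Adj]
    {μv : V → Bool → ℝ} {μe : V → V → Bool → Bool → ℝ}
    (hμ : memLocal G (fun _ => Bool) μv μe) {ε : ℝ} (hε : 0 ≤ ε) {y z : V → Bool}
    (hv : ∀ u, ε ≤ μv u (z u))
    (he : ∀ u v, G.Adj u v → (y u = z u ∧ y v = z v) ∨ ε ≤ μe u v (z u) (z v)) :
    memLocal G (fun _ => Bool)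
      (fun u s => μv u s + ε * (labelUnary y u s - labelUnary z u s))
      (fun u v s t => if G.Adj u v then μe u v s t + ε *
        (labelUnary y u s * labelUnary y v t - labelUnary z u s * labelUnary z v t) else 0) := by
  obtain ⟨hv0, he0, hsymm, -, hsum, hl, hr⟩ := hμ
  have hone : ∀ (w : V → Bool) u, ∑ s, labelUnary w u s = 1 := by
    intro w u; simp [labelUnary]
  refine ⟨?_, ?_, ?_, ?_, ?_, ?_, ?_⟩
  · intro u s
    have h0 := hv0 u s
    by_cases hs : s = z u
    · subst hs
      have := hv u
      simp only [labelUnary]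
      split_ifs <;> linarith
    · simp only [labelUnary, hs, if_false]
      split_ifs <;> linarith
  · intro u v huv s t
    have h0 := he0 u v huv s t
    simp only [huv, if_true]
    rcases he u v huv with ⟨h1, h2⟩ | h
    · simpa [labelUnary, h1, h2] using h0
    · by_cases hst : s = z u ∧ t = z v
      · obtain ⟨rfl, rfl⟩ := hst
        simp only [labelUnary]
        split_ifs <;> linarith
      · have hz : labelUnary z u s * labelUnary z v t = 0 := by
          simp only [labelUnary, mul_ite, mul_one, mul_zero]
          grind
        rw [hz, sub_zero]
        simp only [labelUnary]
        split_ifs <;> linarith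
  · intro u v s t
    simp only [G.adj_comm u v, hsymm u v s t, mul_comm (labelUnary _ u s)]
  · intro u v huv s t
    simp [huv]
  · intro u
    simp only [sum_add_distrib, ← mul_sum, sum_sub_distrib, hone, hsum u]
    ring
  · intro u v huv t
    simp only [huv, if_true, sum_add_distrib, ← mul_sum, sum_sub_distrib, ← sum_mul, hone,
      hl u v huv t, one_mul]
  · intro u v huv s
    simp only [huv, if_true, sum_add_distrib, ← mul_sum, sum_sub_distrib, hone,
      hr u v huv s, mul_one]

/-- A pairwise entry equals a unary one when the label of the other node has full mass. -/
lemma memLocal.edge_eq_of_eq_one {V : Type} {G : SimpleGraph V} [DecidableRel G.Adj]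
    {μv : V → Bool → ℝ} {μe : V → V → Bool → Bool → ℝ}
    (hμ : memLocal G (fun _ => Bool) μv μe) {u v : V} (huv : G.Adj u v) {s : Bool}
    (hs : μv u s = 1) (t : Bool) : μe u v s t = μv v t := by
  obtain ⟨-, he0, -, -, hsum, hl, hr⟩ := hμ
  have h1 := hsum u
  have h2 := hl u v huv t
  have h3 := hr u v huv (!s)
  have h4 := he0 u v huv (!s)
  have h5 := h4 true
  have h6 := h4 false
  cases s <;> cases t <;> simp at * <;> linarith

/-- **Persistency of the binary local polytope relaxation**: if `μ'` minimizes
`⟨θ,·⟩` over the local polytope of a binary model (labels `Bool`), then there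
is an energy-minimizing labeling `y*` that agrees with `μ'` on every node
where `μ'` is integral (i.e. `μ'_u(y*_u) = 1` whenever `μ'_u ∈ {0,1}²`). -/
theorem statement_18 (G : SimpleGraph V) [DecidableRel G.Adj]
    (θv : V → Bool → ℝ) (θe : V → V → Bool → Bool → ℝ)
    (hθsym : ∀ u v s t, θe u v s t = θe v u t s)
    (μv : V → Bool → ℝ) (μe : V → V → Bool → Bool → ℝ)
    (hμ : memLocal G (fun _ => Bool) μv μe)
    (hmin : ∀ νv νe, memLocal G (fun _ => Bool) νv νe →
        ip G (fun _ => Bool) θv θe μv μe ≤ ip G (fun _ => Bool) θv θe νv νe) :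
    ∃ ystar : V → Bool,
      (∀ y : V → Bool, energyB G θv θe ystar ≤ energyB G θv θe y) ∧
      ∀ u : V, (∀ s, μv u s = 0 ∨ μv u s = 1) → μv u (ystar u) = 1 := by
  classical
  obtain ⟨hv0, -, hsymm, -, hsum, -, -⟩ := id hμ
  obtain ⟨y, hy⟩ := Finite.exists_min (energyB G θv θe)
  obtain ⟨ε, hε, hεle⟩ : ∃ ε : ℝ, 0 < ε ∧ ∀ u s, 0 < μv u s → ε ≤ μv u s := by
    obtain hV | hV := isEmpty_or_nonempty V
    · exact ⟨1, one_pos, fun u => hV.elim u⟩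
    · obtain ⟨p, hp⟩ := Finite.exists_min
        fun p : V × Bool => if 0 < μv p.1 p.2 then μv p.1 p.2 else 1
      refine ⟨if 0 < μv p.1 p.2 then μv p.1 p.2 else 1, ?_, fun u s hus => ?_⟩
      · split_ifs with h
        exacts [h, one_pos]
      · simpa only [hus, if_true] using hp (u, s)
  let z : V → Bool := fun u =>
    if ∀ s, μv u s = 0 ∨ μv u s = 1 then decide (μv u true = 1) else y u
  have hzint : ∀ u, (∀ s, μv u s = 0 ∨ μv u s = 1) → μv u (z u) = 1 := by
    intro u hu
    have hz : z u = decide (μv u true = 1) := if_pos hu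
    have h1 := hsum u
    rw [Fintype.sum_bool] at h1
    rw [hz]
    by_cases h : μv u true = 1
    · simp [h]
    · rw [(hu true).resolve_right h, zero_add] at h1
      simp [h, h1]
  have hzfrac : ∀ u, (¬ ∀ s, μv u s = 0 ∨ μv u s = 1) → y u = z u := fun u hu =>
    (if_neg hu).symm
  have hzpos : ∀ u, ε ≤ μv u (z u) := by
    intro u
    refine hεle _ _ ?_
    by_cases hu : ∀ s, μv u s = 0 ∨ μv u s = 1
    · rw [hzint u hu]
      exact one_pos
    · refine lt_of_le_of_ne (hv0 _ _) fun h0 => hu fun s => ?_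
      have h1 := hsum u
      rw [Fintype.sum_bool] at h1
      cases hz : z u <;> rw [hz] at h0 <;> cases s <;> grind
  refine ⟨z, fun w => le_trans ?_ (hy w), hzint⟩
  have hmem := memLocal_add_label_sub G hμ hε.le (y := y) hzpos fun u v huv => by
    by_cases hu : ∀ s, μv u s = 0 ∨ μv u s = 1
    · exact Or.inr ((hzpos v).trans_eq (hμ.edge_eq_of_eq_one huv (hzint u hu) _).symm)
    by_cases hv : ∀ s, μv v s = 0 ∨ μv v s = 1
    · rw [hsymm u v]
      exact Or.inr ((hzpos u).trans_eq (hμ.edge_eq_of_eq_one huv.symm (hzint v hv) _).symm)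
    · exact Or.inl ⟨hzfrac u hu, hzfrac v hv⟩
  have h := hmin _ _ hmem
  rw [ip_add_label_sub] at h
  exact sub_nonneg.mp (nonneg_of_mul_nonneg_right (by linarith) hε)
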